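/- Let $N\geq 2$, $1\leq d<N$, $0<p<q\leq\infty$, $s>\sigma_p := N(1/p-1)_+$, and let $\Psi$ be an admissible function satisfying $\sum_{j\geq 0}\Psi(2^{-j})^{\chi} < \infty$ with $\chi = qp/(q-p)$ (resp. $\chi = p$ if $q=\infty$). If $f \in B^s_{p,q}(\mathbb{R}^N)$, then $f(\cdot, y) \in B^{(s,\Psi)}_{p,q}(\mathbb{R}^d)$ for almost every $y \in \mathbb{R}^{N-d}$. -/

import Mathlib

open MeasureTheory
open scoped ENNReal

noncomputable section

/-- The `M`-th iterated difference operator `Δ_h^M f`. -/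
def iterDiff {E : Type*} [AddCommGroup E] [Module ℝ E] (M : ℕ) (f : E → ℝ) (h : E) :
    E → ℝ :=
  fun x => ∑ i ∈ Finset.range (M + 1), (-1 : ℝ) ^ (M - i) * (M.choose i) * f (x + (i : ℝ) • h)

/-- `σ_p = N (1/p - 1)_+`. -/
def sigmaP (n : ℕ) (p : ℝ≥0∞) : ℝ := n * max (1 / p.toReal - 1) 0

/-- The Besov quasi-norm on `ℝ^n`, defined via `M = ⌊s⌋ + 1` iterated differences:
`‖f‖_{L^p} + (∫_{|h|≤1} ‖Δ_h^M f‖_{L^p}^q |h|^{-n-sq} dh)^{1/q}`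
(usual modification if `q = ∞`). -/
def besovNorm (n : ℕ) (p q : ℝ≥0∞) (s : ℝ) (f : (Fin n → ℝ) → ℝ) : ℝ≥0∞ :=
  eLpNorm f p volume +
    (if q = ⊤ then
      ⨆ (h : Fin n → ℝ) (_ : ‖h‖ ≤ 1),
        eLpNorm (iterDiff (⌊s⌋₊ + 1) f h) p volume * ENNReal.ofReal (‖h‖ ^ (-s))
    else
      (∫⁻ h in {h : Fin n → ℝ | ‖h‖ ≤ 1},
          eLpNorm (iterDiff (⌊s⌋₊ + 1) f h) p volume ^ q.toReal *
            ENNReal.ofReal (‖h‖ ^ (-(n : ℝ) - s * q.toReal))) ^ (1 / q.toReal))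

/-- Membership in the Besov space `B^s_{p,q}(ℝ^n)`. -/
def MemBesov (n : ℕ) (p q : ℝ≥0∞) (s : ℝ) (f : (Fin n → ℝ) → ℝ) : Prop :=
  AEStronglyMeasurable f volume ∧ besovNorm n p q s f < ⊤

/-- The restriction `f(·, y)` of `f : ℝ^N → ℝ` to the `d`-plane with last `N - d`
coordinates equal to `y`. -/
def restrictLast (N d : ℕ) (f : (Fin N → ℝ) → ℝ) (y : Fin (N - d) → ℝ) :
    (Fin d → ℝ) → ℝ :=
  fun x => f fun i =>
    if h : (i : ℕ) < d then x ⟨i, h⟩ else y ⟨(i : ℕ) - d, by have := i.isLt; omega⟩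

end

/-- A positive function on `(0,1]` is *admissible* if it is monotone and satisfies
`Ψ(2^{-j}) ∼ Ψ(2^{-2j})` uniformly in `j ∈ ℕ`. -/
def Admissible (Ψ : ℝ → ℝ) : Prop :=
  (∀ t ∈ Set.Ioc (0 : ℝ) 1, 0 < Ψ t) ∧
    (MonotoneOn Ψ (Set.Ioc (0 : ℝ) 1) ∨ AntitoneOn Ψ (Set.Ioc (0 : ℝ) 1)) ∧
    ∃ c C : ℝ, 0 < c ∧
      ∀ j : ℕ, c * Ψ ((2 : ℝ) ^ (-(2 * j : ℝ))) ≤ Ψ ((2 : ℝ) ^ (-(j : ℝ))) ∧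
        Ψ ((2 : ℝ) ^ (-(j : ℝ))) ≤ C * Ψ ((2 : ℝ) ^ (-(2 * j : ℝ)))

/-- The exponent `χ = qp/(q-p)` (resp. `χ = p` if `q = ∞`). -/
noncomputable def chiExp (p : ℝ≥0∞) (q : ℝ≥0∞) : ℝ :=
  if q = ⊤ then p.toReal else q.toReal * p.toReal / (q.toReal - p.toReal)

noncomputable section

/-- The quasi-norm of the Besov space of generalized smoothness `B^{(s,Ψ)}_{p,q}(ℝ^n)`,
defined with `M = ⌊s⌋ + 1` iterated differences as
`‖f‖_{L^p} + (∫_0^1 sup_{|h|≤t} ‖Δ_h^M f‖_{L^p}^q Ψ(t)^q t^{-1-sq} dt)^{1/q}`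
(usual modification if `q = ∞`). -/
def genBesovNorm (n : ℕ) (p q : ℝ≥0∞) (s : ℝ) (Ψ : ℝ → ℝ) (f : (Fin n → ℝ) → ℝ) : ℝ≥0∞ :=
  eLpNorm f p volume +
    (if q = ⊤ then
      ⨆ (t : ℝ) (_ : t ∈ Set.Ioc (0 : ℝ) 1),
        (⨆ (h : Fin n → ℝ) (_ : ‖h‖ ≤ t), eLpNorm (iterDiff (⌊s⌋₊ + 1) f h) p volume) *
          ENNReal.ofReal (Ψ t * t ^ (-s))
    else
      (∫⁻ t in Set.Ioc (0 : ℝ) 1,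
          (⨆ (h : Fin n → ℝ) (_ : ‖h‖ ≤ t), eLpNorm (iterDiff (⌊s⌋₊ + 1) f h) p volume) ^
              q.toReal *
            ENNReal.ofReal (Ψ t ^ q.toReal * t ^ (-1 - s * q.toReal))) ^ (1 / q.toReal))

/-- Membership in the Besov space of generalized smoothness `B^{(s,Ψ)}_{p,q}(ℝ^n)`. -/
def MemGenBesov (n : ℕ) (p q : ℝ≥0∞) (s : ℝ) (Ψ : ℝ → ℝ) (f : (Fin n → ℝ) → ℝ) : Prop :=
  AEStronglyMeasurable f volume ∧ genBesovNorm n p q s Ψ f < ⊤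

end

namespace BesovAux

/-- coefficient of the iterated difference -/
noncomputable def cf (M i : ℕ) : ℝ := (-1 : ℝ) ^ (M - i) * (M.choose i)

lemma iterDiff_eq {E : Type*} [AddCommGroup E] [Module ℝ E] (M : ℕ) (f : E → ℝ) (h x : E) :
    iterDiff M f h x = ∑ i ∈ Finset.range (M + 1), cf M i * f (x + (i : ℝ) • h) := rfl

lemma sum_cf (M : ℕ) (hM : 1 ≤ M) : ∑ i ∈ Finset.range (M + 1), cf M i = 0 := by
  have h := add_pow (1 : ℝ) (-1) M
  simp only [one_pow, one_mul, add_neg_cancel] at h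
  rw [zero_pow (by omega)] at h
  exact h.symm

lemma iterDiff_zero {E : Type*} [AddCommGroup E] [Module ℝ E] (M : ℕ) (hM : 1 ≤ M)
    (f : E → ℝ) (x : E) : iterDiff M f 0 x = 0 := by
  rw [iterDiff_eq]
  simp only [smul_zero, add_zero]
  rw [← Finset.sum_mul, sum_cf M hM, zero_mul]

lemma iterDiff_swap {E : Type*} [AddCommGroup E] [Module ℝ E] (M : ℕ)
    (f : E → ℝ) (h u x : E) :
    ∑ k ∈ Finset.range (M + 1), cf M k * iterDiff M f (h + (k : ℝ) • u) x =
    ∑ l ∈ Finset.range (M + 1), cf M l * iterDiff M f ((l : ℝ) • u) (x + (l : ℝ) • h) := by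
  simp only [iterDiff_eq, Finset.mul_sum]
  rw [Finset.sum_comm]
  refine Finset.sum_congr rfl fun l _ => Finset.sum_congr rfl fun k _ => ?_
  have : x + (l : ℝ) • (h + (k : ℝ) • u) = x + (l : ℝ) • h + (k : ℝ) • (l : ℝ) • u := by
    rw [smul_add, smul_comm (k : ℝ) (l : ℝ) u]; abel
  rw [this]; ring

lemma enorm_cf_le (M i : ℕ) : ‖cf M i‖ₑ ≤ 2 ^ M := by
  have h1 : ‖cf M i‖ = (M.choose i : ℝ) := by
    simp [cf]
  have h2 : (M.choose i : ℝ) ≤ (2 : ℝ) ^ M := by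
    exact_mod_cast Nat.choose_le_two_pow M i
  rw [← ofReal_norm, h1]
  calc ENNReal.ofReal (M.choose i : ℝ) ≤ ENNReal.ofReal ((2 : ℝ) ^ M) := ENNReal.ofReal_le_ofReal h2
    _ = 2 ^ M := by rw [ENNReal.ofReal_pow (by norm_num)]; simp

lemma enorm_iterDiff_le {E : Type*} [AddCommGroup E] [Module ℝ E] (M : ℕ) (hM : 1 ≤ M)
    (f : E → ℝ) (h u x : E) :
    ‖iterDiff M f h x‖ₑ ≤ ∑ k ∈ Finset.range M,
      (2 ^ M * ‖iterDiff M f (((k + 1 : ℕ) : ℝ) • u) (x + ((k + 1 : ℕ) : ℝ) • h)‖ₑ +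
       2 ^ M * ‖iterDiff M f (h + ((k + 1 : ℕ) : ℝ) • u) x‖ₑ) := by
  have key := iterDiff_swap M f h u x
  rw [Finset.sum_range_succ', Finset.sum_range_succ'] at key
  simp only [Nat.cast_zero, zero_smul, add_zero, iterDiff_zero M hM, mul_zero] at key
  have e0 : ‖cf M 0 * iterDiff M f h x‖ₑ = ‖iterDiff M f h x‖ₑ := by
    rw [enorm_mul]
    have : ‖cf M 0‖ₑ = 1 := by
      rw [← ofReal_norm]; simp [cf]
    rw [this, one_mul]
  rw [← e0, eq_sub_of_add_eq' key, ← Finset.sum_sub_distrib]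
  refine (enorm_sum_le _ _).trans (Finset.sum_le_sum fun k _ => ?_)
  refine (enorm_sub_le).trans ?_
  rw [enorm_mul, enorm_mul]
  gcongr <;> exact enorm_cf_le _ _

lemma sum_rpow_le {ι : Type*} (s : Finset ι) (a : ι → ℝ≥0∞) {P : ℝ} (hP : 0 < P) :
    (∑ i ∈ s, a i) ^ P ≤ (s.card : ℝ≥0∞) ^ P * ∑ i ∈ s, a i ^ P := by
  rcases s.eq_empty_or_nonempty with rfl | hs
  · simp [hP]
  obtain ⟨i, hi, him⟩ := s.exists_max_image a hs
  have h1 : ∑ j ∈ s, a j ≤ s.card * a i := by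
    have := Finset.sum_le_card_nsmul s a (a i) him
    simpa [nsmul_eq_mul] using this
  calc (∑ j ∈ s, a j) ^ P ≤ (s.card * a i) ^ P := by gcongr
    _ = (s.card : ℝ≥0∞) ^ P * a i ^ P := ENNReal.mul_rpow_of_nonneg _ _ hP.le
    _ ≤ _ := by
      gcongr
      exact Finset.single_le_sum (f := fun i => a i ^ P) (fun _ _ => zero_le) hi

lemma add_rpow_le (a b : ℝ≥0∞) {P : ℝ} (hP : 0 < P) :
    (a + b) ^ P ≤ (2 : ℝ≥0∞) ^ P * (a ^ P + b ^ P) := by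
  have := sum_rpow_le Finset.univ ![a, b] hP
  simpa using this

/-- The `P`-th power of the `L^P` norm of the difference. -/
noncomputable def DD {n : ℕ} (M : ℕ) (P : ℝ) (f : (Fin n → ℝ) → ℝ) (h : Fin n → ℝ) : ℝ≥0∞ :=
  ∫⁻ x, ‖iterDiff M f h x‖ₑ ^ P

/-- quasi-subadditivity -/
def QS {n : ℕ} (M : ℕ) (F : (Fin n → ℝ) → ℝ≥0∞) : Prop :=
  ∃ C : ℝ≥0∞, C ≠ ⊤ ∧ ∀ h u, F h ≤ C * ∑ k ∈ Finset.range M,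
    (F (((k + 1 : ℕ) : ℝ) • u) + F (h + ((k + 1 : ℕ) : ℝ) • u))

lemma QS.rpow {n M : ℕ} {F : (Fin n → ℝ) → ℝ≥0∞} (hF : QS M F) {r : ℝ} (hr : 0 < r) :
    QS M (fun h => F h ^ r) := by
  obtain ⟨C, hC, H⟩ := hF
  refine ⟨C ^ r * ((M : ℝ≥0∞) ^ r * 2 ^ r), ?_, fun h u => ?_⟩
  · have := ENNReal.rpow_ne_top_of_nonneg hr.le hC
    have h2 := ENNReal.rpow_ne_top_of_nonneg hr.le (ENNReal.natCast_ne_top M)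
    have h3 := ENNReal.rpow_ne_top_of_nonneg hr.le (ENNReal.ofNat_ne_top (n := 2))
    exact ENNReal.mul_ne_top this (ENNReal.mul_ne_top h2 h3)
  · calc F h ^ r ≤ (C * ∑ k ∈ Finset.range M,
        (F (((k + 1 : ℕ) : ℝ) • u) + F (h + ((k + 1 : ℕ) : ℝ) • u))) ^ r := by
          gcongr; exact H h u
      _ ≤ C ^ r * ((M : ℝ≥0∞) ^ r * ∑ k ∈ Finset.range M,
        (F (((k + 1 : ℕ) : ℝ) • u) + F (h + ((k + 1 : ℕ) : ℝ) • u)) ^ r) := by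
          rw [ENNReal.mul_rpow_of_nonneg _ _ hr.le]
          gcongr
          simpa using sum_rpow_le (Finset.range M) (fun k =>
            (F (((k + 1 : ℕ) : ℝ) • u) + F (h + ((k + 1 : ℕ) : ℝ) • u))) hr
      _ ≤ C ^ r * ((M : ℝ≥0∞) ^ r * ∑ k ∈ Finset.range M,
        2 ^ r * (F (((k + 1 : ℕ) : ℝ) • u) ^ r + F (h + ((k + 1 : ℕ) : ℝ) • u) ^ r)) := by
          gcongr
          exact add_rpow_le _ _ hr
      _ = _ := by rw [← Finset.mul_sum]; ring

lemma measurable_iterDiff_joint {n : ℕ} (M : ℕ) {f : (Fin n → ℝ) → ℝ} (hf : Measurable f) :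
    Measurable (fun z : (Fin n → ℝ) × (Fin n → ℝ) => iterDiff M f z.1 z.2) := by
  unfold iterDiff
  refine Finset.measurable_sum _ fun i _ => ?_
  refine Measurable.const_mul (hf.comp ?_) _
  fun_prop

lemma measurable_iterDiff {n : ℕ} (M : ℕ) {f : (Fin n → ℝ) → ℝ} (hf : Measurable f)
    (h : Fin n → ℝ) : Measurable (iterDiff M f h) :=
  (measurable_iterDiff_joint M hf).comp (measurable_const.prodMk measurable_id)

lemma measurable_DD {n : ℕ} (M : ℕ) (P : ℝ) {f : (Fin n → ℝ) → ℝ} (hf : Measurable f) :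
    Measurable (DD M P f) := by
  unfold DD
  exact Measurable.lintegral_prod_right' (f := fun z : (Fin n → ℝ) × (Fin n → ℝ) =>
    ‖iterDiff M f z.1 z.2‖ₑ ^ P) ((measurable_iterDiff_joint M hf).enorm.pow_const P)

lemma DD_zero {n : ℕ} (M : ℕ) (hM : 1 ≤ M) {P : ℝ} (hP : 0 < P) (f : (Fin n → ℝ) → ℝ) :
    DD M P f 0 = 0 := by
  simp [DD, iterDiff_zero M hM, hP]

lemma lintegral_C_sum {α : Type*} [MeasurableSpace α] (μ : Measure α) (C : ℝ≥0∞) (s : Finset ℕ)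
    (a : ℕ → α → ℝ≥0∞) {b : ℕ → α → ℝ≥0∞} (ha : ∀ k, Measurable (a k))
    (hb : ∀ k, Measurable (b k)) :
    ∫⁻ x, C * ∑ k ∈ s, (a k x + b k x) ∂μ = C * ∑ k ∈ s, ((∫⁻ x, a k x ∂μ) + ∫⁻ x, b k x ∂μ) := by
  rw [lintegral_const_mul _ (by fun_prop), lintegral_finsetSum _ (by fun_prop)]
  congr 1
  exact Finset.sum_congr rfl fun k _ => lintegral_add_left (ha k) _

lemma QS_DD {n : ℕ} (M : ℕ) (hM : 1 ≤ M) {P : ℝ} (hP : 0 < P) {f : (Fin n → ℝ) → ℝ}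
    (hf : Measurable f) : QS M (DD M P f) := by
  refine ⟨(M : ℝ≥0∞) ^ P * (2 ^ P * ((2 : ℝ≥0∞) ^ M) ^ P), ?_, fun h u => ?_⟩
  · have h2 := ENNReal.rpow_ne_top_of_nonneg hP.le (ENNReal.natCast_ne_top M)
    have h3 := ENNReal.rpow_ne_top_of_nonneg hP.le (ENNReal.ofNat_ne_top (n := 2))
    have h4 := ENNReal.rpow_ne_top_of_nonneg hP.le
      (ENNReal.pow_ne_top (n := M) (ENNReal.ofNat_ne_top (n := 2)))
    exact ENNReal.mul_ne_top h2 (ENNReal.mul_ne_top h3 h4)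
  · have hpt : ∀ x, ‖iterDiff M f h x‖ₑ ^ P ≤
        (M : ℝ≥0∞) ^ P * (2 ^ P * ((2 : ℝ≥0∞) ^ M) ^ P) * ∑ k ∈ Finset.range M,
        (‖iterDiff M f (((k + 1 : ℕ) : ℝ) • u) (x + ((k + 1 : ℕ) : ℝ) • h)‖ₑ ^ P +
         ‖iterDiff M f (h + ((k + 1 : ℕ) : ℝ) • u) x‖ₑ ^ P) := by
      intro x
      refine (ENNReal.rpow_le_rpow (enorm_iterDiff_le M hM f h u x) hP.le).trans ?_
      refine (sum_rpow_le _ _ hP).trans ?_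
      rw [Finset.card_range, mul_assoc]
      refine mul_le_mul_right ?_ _
      rw [Finset.mul_sum]
      refine Finset.sum_le_sum fun k hk => ?_
      refine (add_rpow_le _ _ hP).trans ?_
      rw [ENNReal.mul_rpow_of_nonneg _ _ hP.le, ENNReal.mul_rpow_of_nonneg _ _ hP.le, mul_assoc,
        ← mul_add]
    have hm1 : ∀ k : ℕ, Measurable fun x =>
        ‖iterDiff M f (((k + 1 : ℕ) : ℝ) • u) (x + ((k + 1 : ℕ) : ℝ) • h)‖ₑ ^ P := fun k =>
      (((measurable_iterDiff M hf _).comp (measurable_id.add_const _)).enorm.pow_const P)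
    have hm2 : ∀ k : ℕ, Measurable fun x =>
        ‖iterDiff M f (h + ((k + 1 : ℕ) : ℝ) • u) x‖ₑ ^ P := fun k =>
      ((measurable_iterDiff M hf _).enorm.pow_const P)
    refine (lintegral_mono hpt).trans ?_
    rw [lintegral_C_sum _ _ _ _ hm1 hm2]
    refine le_of_eq ?_
    congr 1
    refine Finset.sum_congr rfl fun k _ => ?_
    congr 1
    exact lintegral_add_right_eq_self (fun x => ‖iterDiff M f (((k + 1 : ℕ) : ℝ) • u) x‖ₑ ^ P) _

lemma lintegral_dilate {n : ℕ} {F : (Fin n → ℝ) → ℝ≥0∞} (hF : Measurable F) (h : Fin n → ℝ)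
    (k : ℕ) : ∫⁻ u, F (h + ((k + 1 : ℕ) : ℝ) • u) ≤ ∫⁻ v, F v := by
  have hk : (((k + 1 : ℕ) : ℝ)) ≠ 0 := by positivity
  have h1 : ∫⁻ u, F (h + ((k + 1 : ℕ) : ℝ) • u) =
      ∫⁻ v, F (h + v) ∂(Measure.map (fun x : Fin n → ℝ => ((k + 1 : ℕ) : ℝ) • x) volume) := by
    rw [lintegral_map]
    · exact hF.comp (measurable_const.add measurable_id)
    · fun_prop
  rw [h1, Measure.map_addHaar_smul _ hk, lintegral_smul_measure, lintegral_add_left_eq_self]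
  calc _ ≤ (1 : ℝ≥0∞) * ∫⁻ v, F v := by
        rw [smul_eq_mul]
        gcongr
        rw [ENNReal.ofReal_le_one, abs_of_nonneg (by positivity)]
        apply inv_le_one_of_one_le₀
        apply one_le_pow₀
        push_cast
        linarith [Nat.cast_nonneg (α := ℝ) k]
    _ = _ := one_mul _

lemma QS.avg {n M : ℕ} {F : (Fin n → ℝ) → ℝ≥0∞} (hQ : QS M F) (hF : Measurable F) :
    ∃ C : ℝ≥0∞, C ≠ ⊤ ∧ ∀ t : ℝ, 0 < t → ∀ h, ‖h‖ ≤ t →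
      F h * ENNReal.ofReal (t ^ n) ≤
        C * ∫⁻ v in Metric.closedBall 0 ((M + 1) * t), F v := by
  obtain ⟨C, hC, H⟩ := hQ
  refine ⟨C * (M * 2), ENNReal.mul_ne_top hC (ENNReal.mul_ne_top (by simp) (by simp)), ?_⟩
  intro t ht h hh
  set B := Metric.closedBall (0 : Fin n → ℝ) ((M + 1) * t)
  set G := B.indicator F with hG
  have hGm : Measurable G := hF.indicator measurableSet_closedBall
  have hI : ∫⁻ v in B, F v = ∫⁻ v, G v := (lintegral_indicator measurableSet_closedBall _).symm
  have hbd : ∀ (h' : Fin n → ℝ), ‖h'‖ ≤ t → ∀ k < M,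
      ∫⁻ u in Metric.closedBall (0 : Fin n → ℝ) t, F (h' + ((k + 1 : ℕ) : ℝ) • u) ≤ ∫⁻ v, G v := by
    intro h' hh' k hk
    calc _ ≤ ∫⁻ u in Metric.closedBall (0 : Fin n → ℝ) t, G (h' + ((k + 1 : ℕ) : ℝ) • u) := by
          refine setLIntegral_mono' measurableSet_closedBall fun u hu => ?_
          rw [hG, Set.indicator_of_mem]
          rw [mem_closedBall_zero_iff] at hu ⊢
          have hkM : (((k + 1 : ℕ) : ℝ)) ≤ M := by exact_mod_cast hk
          calc ‖h' + ((k + 1 : ℕ) : ℝ) • u‖ ≤ ‖h'‖ + ‖((k + 1 : ℕ) : ℝ) • u‖ := norm_add_le _ _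
            _ = ‖h'‖ + ((k + 1 : ℕ) : ℝ) * ‖u‖ := by rw [norm_smul, Real.norm_natCast]
            _ ≤ t + M * t := by gcongr
            _ = (M + 1) * t := by ring
      _ ≤ ∫⁻ u, G (h' + ((k + 1 : ℕ) : ℝ) • u) := setLIntegral_le_lintegral _ _
      _ ≤ _ := lintegral_dilate hGm h' k
  have hvol : ENNReal.ofReal (t ^ n) ≤ volume (Metric.closedBall (0 : Fin n → ℝ) t) := by
    rw [Real.volume_pi_closedBall _ ht.le, Fintype.card_fin]
    apply ENNReal.ofReal_le_ofReal
    gcongr; linarith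
  have hm1 : ∀ k : ℕ, Measurable fun u : Fin n → ℝ => F (((k + 1 : ℕ) : ℝ) • u) := fun k =>
    hF.comp (by fun_prop)
  have hm2 : ∀ k : ℕ, Measurable fun u : Fin n → ℝ => F (h + ((k + 1 : ℕ) : ℝ) • u) := fun k =>
    hF.comp (by fun_prop)
  calc F h * ENNReal.ofReal (t ^ n) ≤ F h * volume (Metric.closedBall (0 : Fin n → ℝ) t) := by
        gcongr
    _ = ∫⁻ u in Metric.closedBall (0 : Fin n → ℝ) t, F h := by rw [setLIntegral_const]
    _ ≤ ∫⁻ u in Metric.closedBall (0 : Fin n → ℝ) t, C * ∑ k ∈ Finset.range M,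
        (F (((k + 1 : ℕ) : ℝ) • u) + F (h + ((k + 1 : ℕ) : ℝ) • u)) :=
        lintegral_mono fun u => H h u
    _ = C * ∑ k ∈ Finset.range M,
        ((∫⁻ u in Metric.closedBall (0 : Fin n → ℝ) t, F (((k + 1 : ℕ) : ℝ) • u)) +
         ∫⁻ u in Metric.closedBall (0 : Fin n → ℝ) t, F (h + ((k + 1 : ℕ) : ℝ) • u)) := by
        exact lintegral_C_sum _ _ _ _ hm1 hm2
    _ ≤ C * ∑ k ∈ Finset.range M, ((∫⁻ v, G v) + ∫⁻ v, G v) := by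
        refine mul_le_mul_right (Finset.sum_le_sum fun k hk => add_le_add ?_ ?_) _
        · have := hbd 0 (by simpa using ht.le) k (Finset.mem_range.1 hk)
          simpa using this
        · exact hbd h hh k (Finset.mem_range.1 hk)
    _ = C * (M * 2) * ∫⁻ v in B, F v := by
        rw [hI, Finset.sum_const, Finset.card_range, nsmul_eq_mul]; ring

lemma DD_le {n : ℕ} (M : ℕ) {P : ℝ} (hP : 0 < P) {f : (Fin n → ℝ) → ℝ}
    (hf : Measurable f) : ∃ C : ℝ≥0∞, C ≠ ⊤ ∧ ∀ h, DD M P f h ≤ C * ∫⁻ x, ‖f x‖ₑ ^ P := by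
  refine ⟨((M + 1 : ℕ) : ℝ≥0∞) ^ P * (((2 : ℝ≥0∞) ^ M) ^ P * ((M + 1 : ℕ) : ℝ≥0∞)), ?_,
    fun h => ?_⟩
  · have h2 := ENNReal.rpow_ne_top_of_nonneg hP.le (ENNReal.natCast_ne_top (M + 1))
    have h4 := ENNReal.rpow_ne_top_of_nonneg hP.le
      (ENNReal.pow_ne_top (n := M) (ENNReal.ofNat_ne_top (n := 2)))
    exact ENNReal.mul_ne_top h2 (ENNReal.mul_ne_top h4 (ENNReal.natCast_ne_top (M + 1)))
  · have hpt : ∀ x, ‖iterDiff M f h x‖ₑ ^ P ≤ ((M + 1 : ℕ) : ℝ≥0∞) ^ P * (((2 : ℝ≥0∞) ^ M) ^ P *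
        ∑ i ∈ Finset.range (M + 1), ‖f (x + (i : ℝ) • h)‖ₑ ^ P) := by
      intro x
      have h1 : ‖iterDiff M f h x‖ₑ ≤ ∑ i ∈ Finset.range (M + 1),
          2 ^ M * ‖f (x + (i : ℝ) • h)‖ₑ := by
        rw [iterDiff_eq]
        refine (enorm_sum_le _ _).trans (Finset.sum_le_sum fun k _ => ?_)
        rw [enorm_mul]
        gcongr
        exact enorm_cf_le _ _
      refine (ENNReal.rpow_le_rpow h1 hP.le).trans ?_
      refine (sum_rpow_le _ _ hP).trans ?_
      rw [Finset.card_range]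
      refine mul_le_mul_right ?_ _
      rw [Finset.mul_sum]
      refine Finset.sum_le_sum fun k hk => ?_
      rw [ENNReal.mul_rpow_of_nonneg _ _ hP.le]
    have hm : ∀ i : ℕ, Measurable fun x => ‖f (x + (i : ℝ) • h)‖ₑ ^ P := fun i =>
      (hf.comp (measurable_id.add_const _)).enorm.pow_const P
    refine (lintegral_mono hpt).trans ?_
    rw [lintegral_const_mul _ (by fun_prop), lintegral_const_mul _ (by fun_prop),
      lintegral_finsetSum _ (by fun_prop)]
    have : ∀ i ∈ Finset.range (M + 1), ∫⁻ x, ‖f (x + (i : ℝ) • h)‖ₑ ^ P = ∫⁻ x, ‖f x‖ₑ ^ P :=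
      fun i _ => lintegral_add_right_eq_self (fun x => ‖f x‖ₑ ^ P) _
    rw [Finset.sum_congr rfl this, Finset.sum_const, Finset.card_range, nsmul_eq_mul]
    rw [mul_assoc, mul_assoc]

/-- dyadic scale -/
noncomputable def tau (j : ℕ) : ℝ := (2 : ℝ) ^ (-(j : ℝ))

lemma tau_pos (j : ℕ) : 0 < tau j := Real.rpow_pos_of_pos (by norm_num) _

lemma tau_eq (j : ℕ) : tau j = (1 / 2 : ℝ) ^ j := by
  rw [tau, Real.rpow_neg (by norm_num), Real.rpow_natCast, one_div, inv_pow]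

lemma tau_le_one (j : ℕ) : tau j ≤ 1 := by
  rw [tau_eq]; exact pow_le_one₀ (by norm_num) (by norm_num)

lemma tau_succ (j : ℕ) : tau (j + 1) = tau j / 2 := by
  rw [tau_eq, tau_eq, pow_succ]; ring

lemma tau_anti {i j : ℕ} (h : i ≤ j) : tau j ≤ tau i := by
  rw [tau_eq, tau_eq]; exact pow_le_pow_of_le_one (by norm_num) (by norm_num) h

lemma geo {α : ℝ} (hα : 0 < α) (n : ℕ) : ∀ R : ℝ, 0 < R →
    ∑ j ∈ Finset.range n, (if R ≤ tau j then tau j ^ (-α) else 0) ≤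
      (1 / (1 - (2 : ℝ) ^ (-α))) * R ^ (-α) := by
  have h2 : (2 : ℝ) ^ (-α) < 1 := Real.rpow_lt_one_of_one_lt_of_neg (by norm_num) (by linarith)
  have hK : 0 < 1 - (2 : ℝ) ^ (-α) := by linarith
  induction n with
  | zero => intro R hR; simp; positivity
  | succ n ih =>
    intro R hR
    rw [Finset.sum_range_succ]
    by_cases hn : R ≤ tau n
    · rw [if_pos hn]
      have e : ∑ j ∈ Finset.range n, (if R ≤ tau j then tau j ^ (-α) else 0) ≤
          ∑ j ∈ Finset.range n, (if 2 * R ≤ tau j then tau j ^ (-α) else 0) := by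
        refine Finset.sum_le_sum fun j hj => ?_
        have hj' : tau n ≤ tau j / 2 := by
          rw [← tau_succ]; exact tau_anti (Finset.mem_range.1 hj)
        rw [if_pos (by linarith), if_pos (by linarith)]
      have h3 := ih (2 * R) (by positivity)
      have h4 : tau n ^ (-α) ≤ R ^ (-α) :=
        Real.rpow_le_rpow_of_nonpos hR hn (by linarith)
      rw [Real.mul_rpow (by norm_num) hR.le] at h3
      have h5 : (1 / (1 - (2 : ℝ) ^ (-α))) * R ^ (-α) =
        1 / (1 - (2 : ℝ) ^ (-α)) * (2 ^ (-α) * R ^ (-α)) + R ^ (-α) := by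
        field_simp; ring
      linarith
    · rw [if_neg hn, add_zero]; exact ih R hR

lemma geo_tsum {α : ℝ} (hα : 0 < α) : ∃ K : ℝ≥0∞, K ≠ ⊤ ∧ ∀ R : ℝ, 0 < R →
    ∑' j : ℕ, (if R ≤ tau j then ENNReal.ofReal (tau j ^ (-α)) else 0) ≤
      K * ENNReal.ofReal (R ^ (-α)) := by
  have h2 : (2 : ℝ) ^ (-α) < 1 := Real.rpow_lt_one_of_one_lt_of_neg (by norm_num) (by linarith)
  refine ⟨ENNReal.ofReal (1 / (1 - (2 : ℝ) ^ (-α))), ENNReal.ofReal_ne_top, fun R hR => ?_⟩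
  refine ENNReal.tsum_le_of_sum_range_le fun n => ?_
  rw [← ENNReal.ofReal_mul (by apply one_div_nonneg.2; linarith)]
  refine le_trans (le_of_eq ?_) (ENNReal.ofReal_le_ofReal (geo hα n R hR))
  rw [ENNReal.ofReal_sum_of_nonneg]
  · refine Finset.sum_congr rfl fun j _ => ?_
    split_ifs <;> simp
  · intro j _
    split_ifs
    · exact Real.rpow_nonneg (tau_pos j).le _
    · exact le_rfl

/-- sup of `DD` over a dyadic ball -/
noncomputable def bb {n : ℕ} (M : ℕ) (P : ℝ) (f : (Fin n → ℝ) → ℝ) (j : ℕ) : ℝ≥0∞ :=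
  ⨆ (h : Fin n → ℝ) (_ : ‖h‖ ≤ (M + 1) * tau j), DD M P f h

lemma bb_lt_top {n : ℕ} (M : ℕ) {P : ℝ} (hP : 0 < P) {f : (Fin n → ℝ) → ℝ}
    (hf : Measurable f) (hLp : ∫⁻ x, ‖f x‖ₑ ^ P < ⊤) (j : ℕ) : bb M P f j < ⊤ := by
  obtain ⟨C, hC, H⟩ := DD_le M hP hf
  exact (iSup₂_le fun h _ => H h).trans_lt (ENNReal.mul_lt_top hC.lt_top hLp)

lemma exists_tau_le {L : ℝ} (hL : 0 < L) : ∃ j0 : ℕ, L * tau j0 ≤ 1 := by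
  obtain ⟨k, hk⟩ := exists_pow_lt_of_lt_one (inv_pos.2 hL) (by norm_num : (1 / 2 : ℝ) < 1)
  refine ⟨k, ?_⟩
  rw [tau_eq]
  calc L * (1 / 2) ^ k ≤ L * L⁻¹ := by gcongr
    _ = 1 := mul_inv_cancel₀ hL.ne'

lemma tsum_lt_top_of_tail {a : ℕ → ℝ≥0∞} (ha : ∀ j, a j < ⊤) (j0 : ℕ)
    (h : ∑' j, a (j + j0) < ⊤) : ∑' j, a j < ⊤ := by
  rw [← Summable.sum_add_tsum_nat_add' (f := a) (k := j0) ENNReal.summable]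
  exact ENNReal.add_lt_top.2 ⟨ENNReal.sum_lt_top.2 fun i _ => ha i, h⟩

lemma bsum {n : ℕ} (M : ℕ) (hM : 1 ≤ M) {P Q s : ℝ} (hP : 0 < P) (hQ : 0 < Q) (hs : 0 < s)
    {f : (Fin n → ℝ) → ℝ} (hf : Measurable f) (hLp : ∫⁻ x, ‖f x‖ₑ ^ P < ⊤)
    (hB : ∫⁻ h in {h : Fin n → ℝ | ‖h‖ ≤ 1}, DD M P f h ^ (Q / P) *
      ENNReal.ofReal (‖h‖ ^ (-(n : ℝ) - s * Q)) < ⊤) :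
    ∑' j, (ENNReal.ofReal (tau j ^ (-(s * P))) * bb M P f j) ^ (Q / P) < ⊤ := by
  have hr : 0 < Q / P := div_pos hQ hP
  set r := Q / P with hrdef
  obtain ⟨C, hC, H⟩ := ((QS_DD M hM hP hf).rpow hr).avg ((measurable_DD M P hf).pow_const r)
  set L : ℝ := (M + 1) * (M + 1) with hLdef
  have hL : 0 < L := by positivity
  obtain ⟨j0, hj0⟩ := exists_tau_le hL
  set α : ℝ := n + s * Q with hα
  have hαpos : 0 < α := by positivity
  obtain ⟨K, hK, HK⟩ := geo_tsum hαpos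
  have hterm : ∀ j, L * tau j ≤ 1 →
      (ENNReal.ofReal (tau j ^ (-(s * P))) * bb M P f j) ^ r ≤
      C * ∫⁻ v in {h : Fin n → ℝ | ‖h‖ ≤ 1}, DD M P f v ^ r *
        (if ‖v‖ / L ≤ tau j then ENNReal.ofReal (tau j ^ (-α)) else 0) := by
    intro j hj
    have ht : 0 < tau j := tau_pos j
    have hb : bb M P f j ^ r ≤ C * ENNReal.ofReal (tau j ^ (-(n : ℝ))) *
        ∫⁻ v in Metric.closedBall 0 (L * tau j), DD M P f v ^ r := by
      rw [← ENNReal.le_rpow_inv_iff hr]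
      refine iSup₂_le fun h hh => ?_
      rw [ENNReal.le_rpow_inv_iff hr]
      have h1 := H ((M + 1) * tau j) (by positivity) h hh
      rw [← mul_assoc, ← hLdef] at h1
      have h2 : ENNReal.ofReal (tau j ^ n) ≤ ENNReal.ofReal (((M + 1) * tau j) ^ n) := by
        apply ENNReal.ofReal_le_ofReal
        gcongr
        nlinarith [Nat.cast_nonneg (α := ℝ) M]
      have h3 : ENNReal.ofReal (tau j ^ n) * ENNReal.ofReal (tau j ^ (-(n : ℝ))) = 1 := by
        rw [← ENNReal.ofReal_mul (by positivity), ← Real.rpow_natCast, ← Real.rpow_add ht]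
        simp
      calc DD M P f h ^ r = DD M P f h ^ r * ENNReal.ofReal (tau j ^ n) *
            ENNReal.ofReal (tau j ^ (-(n : ℝ))) := by rw [mul_assoc, h3, mul_one]
        _ ≤ DD M P f h ^ r * ENNReal.ofReal (((M + 1) * tau j) ^ n) *
            ENNReal.ofReal (tau j ^ (-(n : ℝ))) := by gcongr
        _ ≤ (C * ∫⁻ v in Metric.closedBall 0 (L * tau j), DD M P f v ^ r) *
            ENNReal.ofReal (tau j ^ (-(n : ℝ))) := by gcongr
        _ = _ := by ring
    have hsplit : ENNReal.ofReal (tau j ^ (-(s * P))) ^ r * ENNReal.ofReal (tau j ^ (-(n : ℝ))) =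
        ENNReal.ofReal (tau j ^ (-α)) := by
      rw [ENNReal.ofReal_rpow_of_nonneg (by positivity) hr.le,
        ← ENNReal.ofReal_mul (by positivity), ← Real.rpow_mul ht.le, ← Real.rpow_add ht]
      congr 2
      rw [hrdef, hα]; field_simp; ring
    have hint : ENNReal.ofReal (tau j ^ (-α)) * ∫⁻ v in Metric.closedBall 0 (L * tau j),
        DD M P f v ^ r ≤ ∫⁻ v in {h : Fin n → ℝ | ‖h‖ ≤ 1}, DD M P f v ^ r *
        (if ‖v‖ / L ≤ tau j then ENNReal.ofReal (tau j ^ (-α)) else 0) := by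
      rw [← lintegral_const_mul _ ((measurable_DD M P hf).pow_const r)]
      calc _ = ∫⁻ v in Metric.closedBall 0 (L * tau j), DD M P f v ^ r *
            (if ‖v‖ / L ≤ tau j then ENNReal.ofReal (tau j ^ (-α)) else 0) := by
            refine setLIntegral_congr_fun measurableSet_closedBall fun v hv => ?_
            rw [mem_closedBall_zero_iff] at hv
            rw [if_pos (by rw [div_le_iff₀ hL]; linarith), mul_comm]
        _ ≤ _ := by
            refine lintegral_mono_set fun v hv => ?_
            rw [mem_closedBall_zero_iff] at hv
            exact hv.trans hj
    rw [ENNReal.mul_rpow_of_nonneg _ _ hr.le]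
    calc _ ≤ ENNReal.ofReal (tau j ^ (-(s * P))) ^ r * (C * ENNReal.ofReal (tau j ^ (-(n : ℝ))) *
        ∫⁻ v in Metric.closedBall 0 (L * tau j), DD M P f v ^ r) := by gcongr
      _ = C * ((ENNReal.ofReal (tau j ^ (-(s * P))) ^ r * ENNReal.ofReal (tau j ^ (-(n : ℝ)))) *
        ∫⁻ v in Metric.closedBall 0 (L * tau j), DD M P f v ^ r) := by ring
      _ ≤ _ := by rw [hsplit]; gcongr
  refine tsum_lt_top_of_tail (fun j => ?_) j0 ?_
  · exact ENNReal.rpow_lt_top_of_nonneg hr.le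
      (ENNReal.mul_lt_top ENNReal.ofReal_lt_top (bb_lt_top M hP hf hLp j)).ne
  · have hmeas : ∀ j : ℕ, Measurable fun v : Fin n → ℝ => DD M P f v ^ r *
        (if ‖v‖ / L ≤ tau j then ENNReal.ofReal (tau j ^ (-α)) else 0) := by
      intro j
      refine ((measurable_DD M P hf).pow_const r).mul (Measurable.ite ?_ measurable_const
        measurable_const)
      exact measurableSet_le (by fun_prop) measurable_const
    calc _ ≤ ∑' j, C * ∫⁻ v in {h : Fin n → ℝ | ‖h‖ ≤ 1}, DD M P f v ^ r *
        (if ‖v‖ / L ≤ tau (j + j0) then ENNReal.ofReal (tau (j + j0) ^ (-α)) else 0) := by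
          refine ENNReal.tsum_le_tsum fun j => hterm _ (le_trans ?_ hj0)
          gcongr
          exact tau_anti (by omega)
      _ ≤ ∑' j, C * ∫⁻ v in {h : Fin n → ℝ | ‖h‖ ≤ 1}, DD M P f v ^ r *
        (if ‖v‖ / L ≤ tau j then ENNReal.ofReal (tau j ^ (-α)) else 0) :=
          ENNReal.tsum_comp_le_tsum_of_injective (add_left_injective j0) (fun j =>
            C * ∫⁻ v in {h : Fin n → ℝ | ‖h‖ ≤ 1}, DD M P f v ^ r *
            (if ‖v‖ / L ≤ tau j then ENNReal.ofReal (tau j ^ (-α)) else 0))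
      _ = C * ∫⁻ v in {h : Fin n → ℝ | ‖h‖ ≤ 1}, ∑' j, DD M P f v ^ r *
        (if ‖v‖ / L ≤ tau j then ENNReal.ofReal (tau j ^ (-α)) else 0) := by
          rw [ENNReal.tsum_mul_left, lintegral_tsum fun j => (hmeas j).aemeasurable]
      _ ≤ C * ∫⁻ v in {h : Fin n → ℝ | ‖h‖ ≤ 1}, (K * ENNReal.ofReal (L ^ α)) *
          (DD M P f v ^ r * ENNReal.ofReal (‖v‖ ^ (-(n : ℝ) - s * Q))) := by
          gcongr with v
          rw [ENNReal.tsum_mul_left]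
          by_cases hv : v = 0
          · rw [hv, DD_zero M hM hP, ENNReal.zero_rpow_of_pos hr]; simp
          · have hv' : 0 < ‖v‖ := norm_pos_iff.2 hv
            calc _ ≤ DD M P f v ^ r * (K * ENNReal.ofReal ((‖v‖ / L) ^ (-α))) := by
                  gcongr
                  exact HK _ (by positivity)
              _ = DD M P f v ^ r * (K * (ENNReal.ofReal (L ^ α) *
                  ENNReal.ofReal (‖v‖ ^ (-(n : ℝ) - s * Q)))) := by
                  rw [← ENNReal.ofReal_mul (by positivity)]
                  congr 3
                  rw [Real.div_rpow hv'.le hL.le, Real.rpow_neg hL.le, div_inv_eq_mul, mul_comm]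
                  congr 2
                  rw [hα]; ring
              _ = _ := by ring
      _ = C * ((K * ENNReal.ofReal (L ^ α)) * ∫⁻ v in {h : Fin n → ℝ | ‖h‖ ≤ 1},
          (DD M P f v ^ r * ENNReal.ofReal (‖v‖ ^ (-(n : ℝ) - s * Q)))) := by
          rw [lintegral_const_mul' _ _ (ENNReal.mul_ne_top hK ENNReal.ofReal_ne_top)]
      _ < ⊤ := ENNReal.mul_lt_top hC.lt_top (ENNReal.mul_lt_top
          (ENNReal.mul_lt_top hK.lt_top ENNReal.ofReal_lt_top) hB)

lemma eLpNorm_iterDiff {n : ℕ} {p : ℝ≥0∞} (hp0 : p ≠ 0) (hpt : p ≠ ⊤) (M : ℕ)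
    (f : (Fin n → ℝ) → ℝ) (h : Fin n → ℝ) :
    eLpNorm (iterDiff M f h) p volume = DD M p.toReal f h ^ (1 / p.toReal) :=
  eLpNorm_eq_lintegral_rpow_enorm_toReal hp0 hpt

lemma lintegral_lt_top_of_eLpNorm {n : ℕ} {p : ℝ≥0∞} (hp0 : p ≠ 0) (hpt : p ≠ ⊤)
    {f : (Fin n → ℝ) → ℝ} (h : eLpNorm f p volume < ⊤) : ∫⁻ x, ‖f x‖ₑ ^ p.toReal < ⊤ := by
  have hP : 0 < p.toReal := ENNReal.toReal_pos hp0 hpt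
  rw [eLpNorm_eq_lintegral_rpow_enorm_toReal hp0 hpt] at h
  exact (ENNReal.rpow_lt_top_iff_of_pos (by positivity)).1 h

lemma exists_dyadic {t : ℝ} (ht : t ∈ Set.Ioc (0 : ℝ) 1) : ∃ j, tau (j + 1) < t ∧ t ≤ tau j := by
  obtain ⟨j, h1, h2⟩ := exists_nat_pow_near_of_lt_one ht.1 ht.2 (y := (1 / 2 : ℝ))
    (by norm_num) (by norm_num)
  exact ⟨j, by rw [tau_eq]; exact h1, by rw [tau_eq]; exact h2⟩

/-- the supremum over the ball of radius `tau j` -/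
noncomputable def SS {n : ℕ} (M : ℕ) (P : ℝ) (f : (Fin n → ℝ) → ℝ) (j : ℕ) : ℝ≥0∞ :=
  ⨆ (h : Fin n → ℝ) (_ : ‖h‖ ≤ tau j), DD M P f h

lemma tsum_rpow_lt_top {a : ℕ → ℝ≥0∞} (ha : ∑' j, a j < ⊤) {r : ℝ} (hr : 1 ≤ r) :
    ∑' j, a j ^ r < ⊤ := by
  set T := ∑' j, a j
  have h : ∀ j, a j ^ r ≤ T ^ (r - 1) * a j := by
    intro j
    have h1 : a j ≤ T := ENNReal.le_tsum j
    have h2 : a j ^ r = a j ^ (r - 1) * a j := by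
      conv_lhs => rw [show r = (r - 1) + 1 by ring]
      rw [ENNReal.rpow_add_of_nonneg _ _ (by linarith) (by norm_num), ENNReal.rpow_one]
    rw [h2]
    exact mul_le_mul_left (ENNReal.rpow_le_rpow h1 (by linarith)) _
  refine (ENNReal.tsum_le_tsum h).trans_lt ?_
  rw [ENNReal.tsum_mul_left]
  exact ENNReal.mul_lt_top (ENNReal.rpow_lt_top_of_nonneg (by linarith) ha.ne) ha

lemma finish {n : ℕ} {p q : ℝ≥0∞} (hp0 : p ≠ 0) (hpq : p < q) {s : ℝ} (hs : 0 < s)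
    {Ψ : ℝ → ℝ} (hpos : ∀ t ∈ Set.Ioc (0 : ℝ) 1, 0 < Ψ t)
    (hmono : MonotoneOn Ψ (Set.Ioc (0 : ℝ) 1)) {g : (Fin n → ℝ) → ℝ}
    (hLp : eLpNorm g p volume < ⊤)
    (hsum : ∑' j, SS (⌊s⌋₊ + 1) p.toReal g j *
      ENNReal.ofReal (tau j ^ (-(s * p.toReal)) * Ψ (tau j) ^ p.toReal) < ⊤) :
    genBesovNorm n p q s Ψ g < ⊤ := by
  have hpt : p ≠ ⊤ := hpq.ne_top
  have hP : 0 < p.toReal := ENNReal.toReal_pos hp0 hpt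
  set P := p.toReal with hPdef
  set M := ⌊s⌋₊ + 1 with hMdef
  have htauI : ∀ j, tau j ∈ Set.Ioc (0 : ℝ) 1 := fun j => ⟨tau_pos j, tau_le_one j⟩
  have hsup : ∀ t j, t ≤ tau j →
      (⨆ (h : Fin n → ℝ) (_ : ‖h‖ ≤ t), eLpNorm (iterDiff M g h) p volume) ≤
        SS M P g j ^ (1 / P) := by
    intro t j htj
    refine iSup₂_le fun h hh => ?_
    rw [eLpNorm_iterDiff hp0 hpt]
    gcongr
    exact le_iSup₂_of_le h (hh.trans htj) le_rfl
  unfold genBesovNorm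
  refine ENNReal.add_lt_top.2 ⟨hLp, ?_⟩
  split_ifs with hq
  · set T := ∑' j, SS M P g j * ENNReal.ofReal (tau j ^ (-(s * P)) * Ψ (tau j) ^ P)
    have hT : T ^ (1 / P) * ENNReal.ofReal ((2 : ℝ) ^ s) < ⊤ :=
      ENNReal.mul_lt_top (ENNReal.rpow_lt_top_of_nonneg (by positivity) hsum.ne)
        ENNReal.ofReal_lt_top
    refine lt_of_le_of_lt (iSup₂_le fun t ht => ?_) hT
    obtain ⟨j, hj1, hj2⟩ := exists_dyadic ht
    rw [tau_succ] at hj1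
    have hτ := tau_pos j
    have hΨj := hpos _ (htauI j)
    have hreal : Ψ t * t ^ (-s) ≤ (tau j ^ (-(s * P)) * Ψ (tau j) ^ P) ^ (1 / P) * 2 ^ s := by
      have e1 : (tau j ^ (-(s * P)) * Ψ (tau j) ^ P) ^ (1 / P) = tau j ^ (-s) * Ψ (tau j) := by
        rw [Real.mul_rpow (by positivity) (by positivity), ← Real.rpow_mul hτ.le,
          ← Real.rpow_mul hΨj.le, mul_one_div_cancel hP.ne', Real.rpow_one]
        congr 2; field_simp
      have e2 : t ^ (-s) ≤ tau j ^ (-s) * 2 ^ s := by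
        calc t ^ (-s) ≤ (tau j / 2) ^ (-s) :=
              Real.rpow_le_rpow_of_nonpos (by positivity) hj1.le (by linarith)
          _ = tau j ^ (-s) * 2 ^ s := by
              rw [Real.div_rpow hτ.le (by norm_num), Real.rpow_neg (by norm_num : (0:ℝ) ≤ 2),
                div_inv_eq_mul]
      have e3 : Ψ t ≤ Ψ (tau j) := hmono ht (htauI j) hj2
      rw [e1]
      calc Ψ t * t ^ (-s) ≤ Ψ (tau j) * (tau j ^ (-s) * 2 ^ s) := by
            gcongr
            exact Real.rpow_nonneg ht.1.le _
        _ = _ := by ring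
    calc _ ≤ SS M P g j ^ (1 / P) *
          ENNReal.ofReal ((tau j ^ (-(s * P)) * Ψ (tau j) ^ P) ^ (1 / P) * 2 ^ s) := by
          gcongr
          exact hsup t j hj2
      _ = (SS M P g j * ENNReal.ofReal (tau j ^ (-(s * P)) * Ψ (tau j) ^ P)) ^ (1 / P) *
          ENNReal.ofReal ((2 : ℝ) ^ s) := by
          rw [ENNReal.ofReal_mul (by positivity), ENNReal.mul_rpow_of_nonneg _ _ (by positivity),
            ENNReal.ofReal_rpow_of_nonneg (by positivity) (by positivity), mul_assoc]
      _ ≤ _ := by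
          gcongr
          exact ENNReal.le_tsum j
  · have hPQ : P < q.toReal := (ENNReal.toReal_lt_toReal hpt hq).2 hpq
    set Q := q.toReal with hQdef
    have hQ : 0 < Q := hP.trans hPQ
    set r := Q / P with hrdef
    have hr1 : 1 ≤ r := by rw [hrdef, le_div_iff₀ hP]; linarith
    have hr := tsum_rpow_lt_top hsum hr1
    refine ENNReal.rpow_lt_top_of_nonneg (by positivity) (ne_of_lt ?_)
    have hcov : Set.Ioc (0 : ℝ) 1 ⊆ ⋃ j, Set.Ioc (tau (j + 1)) (tau j) := by
      intro t ht
      obtain ⟨j, hj⟩ := exists_dyadic ht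
      exact Set.mem_iUnion.2 ⟨j, hj⟩
    refine (lintegral_mono_set hcov).trans_lt ?_
    refine (lintegral_iUnion_le _ _).trans_lt ?_
    refine lt_of_le_of_lt (ENNReal.tsum_le_tsum (g := fun j =>
      ENNReal.ofReal ((2 : ℝ) ^ (1 + s * Q)) * (SS M P g j *
        ENNReal.ofReal (tau j ^ (-(s * P)) * Ψ (tau j) ^ P)) ^ r) fun j => ?_) ?_
    · have hτ := tau_pos j
      have hΨj := hpos _ (htauI j)
      calc _ ≤ ∫⁻ t in Set.Ioc (tau (j + 1)) (tau j), SS M P g j ^ r *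
            ENNReal.ofReal (Ψ (tau j) ^ Q * (tau j ^ (-1 - s * Q) * 2 ^ (1 + s * Q))) := by
            refine setLIntegral_mono' measurableSet_Ioc fun t ht => ?_
            rw [tau_succ] at ht
            have ht0 : 0 < t := lt_trans (by positivity) ht.1
            have htI : t ∈ Set.Ioc (0 : ℝ) 1 := ⟨ht0, ht.2.trans (tau_le_one j)⟩
            have e2 : t ^ (-1 - s * Q) ≤ tau j ^ (-1 - s * Q) * 2 ^ (1 + s * Q) := by
              have hneg : -1 - s * Q ≤ 0 := by nlinarith [mul_pos hs hQ]
              calc t ^ (-1 - s * Q) ≤ (tau j / 2) ^ (-1 - s * Q) :=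
                    Real.rpow_le_rpow_of_nonpos (by positivity) ht.1.le hneg
                _ = tau j ^ (-1 - s * Q) * 2 ^ (1 + s * Q) := by
                    rw [Real.div_rpow hτ.le (by norm_num),
                      show -1 - s * Q = -(1 + s * Q) by ring,
                      Real.rpow_neg (by norm_num : (0:ℝ) ≤ 2), div_inv_eq_mul]
            have e3 : Ψ t ≤ Ψ (tau j) := hmono htI (htauI j) ht.2
            have e4 := (hpos t htI).le
            have e5 : SS M P g j ^ r = (SS M P g j ^ (1 / P)) ^ Q := by
              rw [← ENNReal.rpow_mul, hrdef]; congr 1; ring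
            rw [e5]
            gcongr
            exact hsup t j ht.2
        _ = SS M P g j ^ r *
            ENNReal.ofReal (Ψ (tau j) ^ Q * (tau j ^ (-1 - s * Q) * 2 ^ (1 + s * Q))) *
            volume (Set.Ioc (tau (j + 1)) (tau j)) := by rw [setLIntegral_const]
        _ ≤ SS M P g j ^ r *
            ENNReal.ofReal (Ψ (tau j) ^ Q * (tau j ^ (-1 - s * Q) * 2 ^ (1 + s * Q))) *
            ENNReal.ofReal (tau j) := by
            rw [Real.volume_Ioc]
            gcongr
            linarith [tau_pos (j + 1)]
        _ = _ := by
            rw [ENNReal.mul_rpow_of_nonneg _ _ (by linarith),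
              ENNReal.ofReal_rpow_of_nonneg (by positivity) (by linarith), mul_assoc,
              ← ENNReal.ofReal_mul (by positivity), mul_left_comm (ENNReal.ofReal ((2 : ℝ) ^ (1 + s * Q))),
              ← ENNReal.ofReal_mul (by positivity)]
            congr 2
            have e1 : (tau j ^ (-(s * P)) * Ψ (tau j) ^ P) ^ r =
                tau j ^ (-(s * Q)) * Ψ (tau j) ^ Q := by
              rw [Real.mul_rpow (by positivity) (by positivity), ← Real.rpow_mul hτ.le,
                ← Real.rpow_mul hΨj.le]
              congr 2
              · rw [hrdef]; field_simp
              · rw [hrdef]; field_simp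
            have e2 : tau j ^ (-(s * Q)) = tau j ^ (-1 - s * Q) * tau j := by
              conv_rhs => rw [← Real.rpow_one (tau j), ← Real.rpow_mul hτ.le]
              rw [one_mul, ← Real.rpow_add hτ]; congr 1; ring
            rw [e1, e2]; ring
    · rw [ENNReal.tsum_mul_left]
      exact ENNReal.mul_lt_top ENNReal.ofReal_lt_top hr

/-- gluing of the two blocks of coordinates -/
def glue (N d : ℕ) (x : Fin d → ℝ) (y : Fin (N - d) → ℝ) : Fin N → ℝ := fun i =>
  if h : (i : ℕ) < d then x ⟨i, h⟩ else y ⟨(i : ℕ) - d, by have := i.isLt; omega⟩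

lemma restrictLast_eq (N d : ℕ) (f : (Fin N → ℝ) → ℝ) (y : Fin (N - d) → ℝ) (x : Fin d → ℝ) :
    restrictLast N d f y x = f (glue N d x y) := rfl

lemma glue_mp (N d : ℕ) (hdN : d < N) :
    MeasurePreserving (fun z : (Fin d → ℝ) × (Fin (N - d) → ℝ) => glue N d z.1 z.2)
      volume volume := by
  let e : Fin d ⊕ Fin (N - d) ≃ Fin N := finSumFinEquiv.trans (finCongr (by omega))
  have h1 := volume_measurePreserving_sumPiEquivProdPi_symm
    (fun _ : Fin d ⊕ Fin (N - d) => ℝ)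
  have h2 := volume_measurePreserving_piCongrLeft (fun _ : Fin N => ℝ) e
  have h3 := h2.comp h1
  convert h3 using 1
  funext z i
  obtain ⟨k, rfl⟩ := e.surjective i
  simp only [Function.comp]
  erw [MeasurableEquiv.piCongrLeft_apply_apply]
  rcases k with k | k
  · have hk : ((e (Sum.inl k) : Fin N) : ℕ) = k := by simp [e]
    simp only [glue, hk, k.isLt, dite_true]
    rfl
  · have hk : ((e (Sum.inr k) : Fin N) : ℕ) = d + k := by simp [e]
    have : ¬ (d + (k : ℕ) < d) := by omega
    simp only [glue, hk, this, dite_false, Nat.add_sub_cancel_left]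
    rfl

lemma glue_add_smul (N d : ℕ) (x h : Fin d → ℝ) (y : Fin (N - d) → ℝ) (c : ℝ) :
    glue N d (x + c • h) y = glue N d x y + c • glue N d h 0 := by
  funext i
  by_cases hi : (i : ℕ) < d <;> simp [glue, hi]

lemma norm_glue_le (N d : ℕ) (h : Fin d → ℝ) : ‖glue N d h 0‖ ≤ ‖h‖ := by
  rw [pi_norm_le_iff_of_nonneg (norm_nonneg _)]
  intro i
  by_cases hi : (i : ℕ) < d
  · simp only [glue, hi, dite_true]; exact norm_le_pi_norm h _
  · simp [glue, hi]

lemma iterDiff_restrict (N d M : ℕ) (f : (Fin N → ℝ) → ℝ) (y : Fin (N - d) → ℝ)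
    (h x : Fin d → ℝ) :
    iterDiff M (restrictLast N d f y) h x = iterDiff M f (glue N d h 0) (glue N d x y) := by
  simp only [iterDiff_eq, restrictLast_eq, glue_add_smul]

lemma lintegral_slice (N d : ℕ) (hdN : d < N) {F : (Fin N → ℝ) → ℝ≥0∞} (hF : Measurable F) :
    ∫⁻ y, ∫⁻ x, F (glue N d x y) = ∫⁻ z, F z := by
  rw [← (glue_mp N d hdN).lintegral_comp hF, Measure.volume_eq_prod]
  exact (lintegral_prod_symm _ (hF.comp (glue_mp N d hdN).measurable).aemeasurable).symm

lemma measurable_restrict (N d : ℕ) (hdN : d < N) {f : (Fin N → ℝ) → ℝ} (hf : Measurable f)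
    (y : Fin (N - d) → ℝ) : Measurable (restrictLast N d f y) :=
  (hf.comp (glue_mp N d hdN).measurable).comp (measurable_id.prodMk measurable_const)

lemma measurable_DD_slice (N d : ℕ) (hdN : d < N) (M : ℕ) (P : ℝ) {f : (Fin N → ℝ) → ℝ}
    (hf : Measurable f) :
    Measurable (fun z : (Fin (N - d) → ℝ) × (Fin d → ℝ) =>
      DD M P (restrictLast N d f z.1) z.2) := by
  unfold DD
  simp only [iterDiff_restrict]
  have hg := (glue_mp N d hdN).measurable
  refine Measurable.lintegral_prod_right'
    (f := fun w : ((Fin (N - d) → ℝ) × (Fin d → ℝ)) × (Fin d → ℝ) =>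
    ‖iterDiff M f (glue N d w.1.2 0) (glue N d w.2 w.1.1)‖ₑ ^ P) ?_
  refine ((measurable_iterDiff_joint M hf).comp (Measurable.prodMk ?_ ?_)).enorm.pow_const P
  · exact hg.comp (by fun_prop : Measurable fun w : ((Fin (N - d) → ℝ) × (Fin d → ℝ)) ×
      (Fin d → ℝ) => ((w.1.2, 0) : (Fin d → ℝ) × (Fin (N - d) → ℝ)))
  · exact hg.comp (by fun_prop : Measurable fun w : ((Fin (N - d) → ℝ) × (Fin d → ℝ)) ×
      (Fin d → ℝ) => ((w.2, w.1.1) : (Fin d → ℝ) × (Fin (N - d) → ℝ)))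

lemma slice_sum (N d : ℕ) (hdN : d < N) (M : ℕ) (hM : 1 ≤ M) {P : ℝ} (hP : 0 < P)
    {f : (Fin N → ℝ) → ℝ} (hf : Measurable f) (w : ℕ → ℝ≥0∞)
    (hw : ∑' j, bb M P f j * w j < ⊤) :
    ∀ᵐ y, ∑' j, SS M P (restrictLast N d f y) j * w j < ⊤ := by
  set a : ℕ → (Fin (N - d) → ℝ) → ℝ≥0∞ := fun j y => ENNReal.ofReal (tau j ^ (-(d : ℝ))) *
    ∫⁻ v in Metric.closedBall 0 ((M + 1) * tau j), DD M P (restrictLast N d f y) v with ha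
  have hma : ∀ j, Measurable (a j) := fun j =>
    Measurable.const_mul (Measurable.lintegral_prod_right' (measurable_DD_slice N d hdN M P hf)) _
  have hia : ∀ j, ∫⁻ y, a j y ≤ ENNReal.ofReal ((2 * (M + 1)) ^ d) * bb M P f j := by
    intro j
    have hτ := tau_pos j
    rw [ha]
    simp only
    rw [lintegral_const_mul' _ _ ENNReal.ofReal_ne_top,
      lintegral_lintegral_swap (measurable_DD_slice N d hdN M P hf).aemeasurable]
    calc _ ≤ ENNReal.ofReal (tau j ^ (-(d : ℝ))) *
          ∫⁻ v in Metric.closedBall (0 : Fin d → ℝ) ((M + 1) * tau j), bb M P f j := by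
          refine mul_le_mul_right (setLIntegral_mono' measurableSet_closedBall fun v hv => ?_) _
          rw [mem_closedBall_zero_iff] at hv
          have : ∫⁻ y, DD M P (restrictLast N d f y) v = DD M P f (glue N d v 0) := by
            unfold DD
            simp only [iterDiff_restrict]
            exact lintegral_slice N d hdN (F := fun z => ‖iterDiff M f (glue N d v 0) z‖ₑ ^ P)
              ((measurable_iterDiff M hf _).enorm.pow_const P)
          rw [this]
          exact le_iSup₂_of_le (f := fun (h : Fin N → ℝ) (_ : ‖h‖ ≤ (M + 1) * tau j) => DD M P f h)
            (glue N d v 0) ((norm_glue_le N d v).trans hv) le_rfl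
      _ = _ := by
          rw [setLIntegral_const, Real.volume_pi_closedBall _ (by positivity), Fintype.card_fin,
            mul_comm (bb M P f j), ← mul_assoc, ← ENNReal.ofReal_mul (by positivity)]
          congr 2
          rw [Real.rpow_neg hτ.le, Real.rpow_natCast, mul_pow, mul_pow, mul_pow]
          field_simp
  have hint : ∫⁻ y, ∑' j, a j y * w j < ⊤ := by
    rw [lintegral_tsum fun j => ((hma j).mul_const _).aemeasurable]
    calc _ ≤ ∑' j, ENNReal.ofReal ((2 * (M + 1)) ^ d) * (bb M P f j * w j) := by
          refine ENNReal.tsum_le_tsum fun j => ?_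
          rw [lintegral_mul_const _ (hma j), ← mul_assoc]
          exact mul_le_mul_left (hia j) _
      _ < ⊤ := by
          rw [ENNReal.tsum_mul_left]
          exact ENNReal.mul_lt_top ENNReal.ofReal_lt_top hw
  have hae := ae_lt_top (Measurable.ennreal_tsum fun j => (hma j).mul_const (w j)) hint.ne
  filter_upwards [hae] with y hy
  have hfy := measurable_restrict N d hdN hf y
  obtain ⟨C, hC, H⟩ := (QS_DD M hM hP hfy).avg (measurable_DD M P hfy)
  have hS : ∀ j, SS M P (restrictLast N d f y) j ≤ C * a j y := by
    intro j
    refine iSup₂_le fun h hh => ?_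
    have hτ := tau_pos j
    have h1 := H (tau j) hτ h hh
    have h3 : ENNReal.ofReal (tau j ^ d) * ENNReal.ofReal (tau j ^ (-(d : ℝ))) = 1 := by
      rw [← ENNReal.ofReal_mul (by positivity), ← Real.rpow_natCast, ← Real.rpow_add hτ]
      simp
    calc _ = DD M P (restrictLast N d f y) h * ENNReal.ofReal (tau j ^ d) *
          ENNReal.ofReal (tau j ^ (-(d : ℝ))) := by rw [mul_assoc, h3, mul_one]
      _ ≤ _ := mul_le_mul_left h1 _
      _ = _ := by rw [ha]; ring
  refine (ENNReal.tsum_le_tsum fun j => mul_le_mul_left (hS j) (w j)).trans_lt ?_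
  simp only [mul_assoc]
  rw [ENNReal.tsum_mul_left]
  exact ENNReal.mul_lt_top hC.lt_top hy

lemma chi_pos {p q : ℝ≥0∞} (hp0 : p ≠ 0) (hpq : p < q) : 0 < chiExp p q := by
  have hP : 0 < p.toReal := ENNReal.toReal_pos hp0 hpq.ne_top
  unfold chiExp
  split_ifs with hq
  · exact hP
  · have hPQ : p.toReal < q.toReal := (ENNReal.toReal_lt_toReal hpq.ne_top hq).2 hpq
    exact div_pos (mul_pos (hP.trans hPQ) hP) (by linarith)

lemma monotone_of_admissible {p q : ℝ≥0∞} (hp0 : p ≠ 0) (hpq : p < q) {Ψ : ℝ → ℝ}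
    (hΨ : Admissible Ψ) (hsum : Summable fun j : ℕ => Ψ (tau j) ^ chiExp p q) :
    MonotoneOn Ψ (Set.Ioc (0 : ℝ) 1) := by
  obtain ⟨hpos, hm | ha, -⟩ := hΨ
  · exact hm
  · exfalso
    have hχ := chi_pos hp0 hpq
    have h1 : (0 : ℝ) < Ψ 1 := hpos 1 (by simp)
    have h2 : ∀ j, Ψ 1 ^ chiExp p q ≤ Ψ (tau j) ^ chiExp p q := fun j =>
      Real.rpow_le_rpow h1.le (ha ⟨tau_pos j, tau_le_one j⟩ (by simp) (tau_le_one j)) hχ.le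
    have h3 := ge_of_tendsto' hsum.tendsto_atTop_zero h2
    have h4 : 0 < Ψ 1 ^ chiExp p q := Real.rpow_pos_of_pos h1 _
    linarith

lemma wsum {n : ℕ} {p q : ℝ≥0∞} (hp0 : p ≠ 0) (hpq : p < q) {s : ℝ} (hs : 0 < s)
    {Ψ : ℝ → ℝ} (hpos : ∀ t ∈ Set.Ioc (0 : ℝ) 1, 0 < Ψ t)
    (hsum : Summable fun j : ℕ => Ψ (tau j) ^ chiExp p q)
    {f : (Fin n → ℝ) → ℝ} (hf : Measurable f) (hB : besovNorm n p q s f < ⊤) :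
    ∑' j, bb (⌊s⌋₊ + 1) p.toReal f j *
      ENNReal.ofReal (tau j ^ (-(s * p.toReal)) * Ψ (tau j) ^ p.toReal) < ⊤ := by
  have hpt : p ≠ ⊤ := hpq.ne_top
  have hP : 0 < p.toReal := ENNReal.toReal_pos hp0 hpt
  unfold besovNorm at hB
  obtain ⟨hLp, hB⟩ := ENNReal.add_lt_top.1 hB
  have hLp' := lintegral_lt_top_of_eLpNorm hp0 hpt hLp
  have hΨ0 : ∀ j, 0 < Ψ (tau j) := fun j => hpos _ ⟨tau_pos j, tau_le_one j⟩
  have hsumE : ∑' j, ENNReal.ofReal (Ψ (tau j) ^ chiExp p q) < ⊤ := hsum.tsum_ofReal_lt_top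
  simp only [eLpNorm_iterDiff hp0 hpt] at hB
  set P := p.toReal with hPdef
  set M := ⌊s⌋₊ + 1 with hMdef
  have hM : 1 ≤ M := by omega
  unfold chiExp at hsumE
  split_ifs at hB hsumE with hq
  · set B := ⨆ (h : Fin n → ℝ) (_ : ‖h‖ ≤ 1), DD M P f h ^ (1 / P) *
        ENNReal.ofReal (‖h‖ ^ (-s)) with hBdef
    have hL : (0 : ℝ) < M + 1 := by positivity
    obtain ⟨j0, hj0⟩ := exists_tau_le hL
    refine tsum_lt_top_of_tail (fun j => ENNReal.mul_lt_top (bb_lt_top M hP hf hLp' j)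
      ENNReal.ofReal_lt_top) j0 ?_
    have hterm : ∀ j, (M + 1) * tau j ≤ 1 → bb M P f j *
        ENNReal.ofReal (tau j ^ (-(s * P)) * Ψ (tau j) ^ P) ≤
        B ^ P * ENNReal.ofReal (((M : ℝ) + 1) ^ (s * P)) * ENNReal.ofReal (Ψ (tau j) ^ P) := by
      intro j hj
      have hτ := tau_pos j
      have hb : bb M P f j ≤ B ^ P * ENNReal.ofReal (((M + 1) * tau j) ^ (s * P)) := by
        refine iSup₂_le fun h hh => ?_
        by_cases h0 : h = 0
        · rw [h0, DD_zero M hM hP]; exact zero_le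
        have hn : 0 < ‖h‖ := norm_pos_iff.2 h0
        have h1 : DD M P f h ^ (1 / P) * ENNReal.ofReal (‖h‖ ^ (-s)) ≤ B :=
          le_iSup₂_of_le (f := fun (h : Fin n → ℝ) (_ : ‖h‖ ≤ 1) => DD M P f h ^ (1 / P) *
            ENNReal.ofReal (‖h‖ ^ (-s))) h (hh.trans hj) le_rfl
        have h2 : DD M P f h * ENNReal.ofReal (‖h‖ ^ (-(s * P))) ≤ B ^ P := by
          have := ENNReal.rpow_le_rpow h1 hP.le
          rw [ENNReal.mul_rpow_of_nonneg _ _ hP.le, ← ENNReal.rpow_mul,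
            one_div_mul_cancel hP.ne', ENNReal.rpow_one,
            ENNReal.ofReal_rpow_of_nonneg (by positivity) hP.le, ← Real.rpow_mul hn.le,
            neg_mul] at this
          exact this
        have h3 : ENNReal.ofReal (‖h‖ ^ (-(s * P))) * ENNReal.ofReal (‖h‖ ^ (s * P)) = 1 := by
          rw [← ENNReal.ofReal_mul (by positivity), ← Real.rpow_add hn]; simp
        calc DD M P f h = DD M P f h * ENNReal.ofReal (‖h‖ ^ (-(s * P))) *
              ENNReal.ofReal (‖h‖ ^ (s * P)) := by rw [mul_assoc, h3, mul_one]
          _ ≤ _ := by gcongr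
      calc _ ≤ B ^ P * ENNReal.ofReal (((M + 1) * tau j) ^ (s * P)) *
            ENNReal.ofReal (tau j ^ (-(s * P)) * Ψ (tau j) ^ P) := by gcongr
        _ = _ := by
          have := hΨ0 j
          rw [mul_assoc, mul_assoc, ← ENNReal.ofReal_mul (by positivity),
            ← ENNReal.ofReal_mul (by positivity)]
          congr 2
          rw [Real.mul_rpow hL.le hτ.le, Real.rpow_neg hτ.le]
          field_simp
    calc _ ≤ ∑' j, B ^ P * ENNReal.ofReal (((M : ℝ) + 1) ^ (s * P)) *
          ENNReal.ofReal (Ψ (tau (j + j0)) ^ P) := by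
          refine ENNReal.tsum_le_tsum fun j => hterm _ (le_trans ?_ hj0)
          gcongr
          exact tau_anti (by omega)
      _ < ⊤ := by
          rw [ENNReal.tsum_mul_left]
          refine ENNReal.mul_lt_top (ENNReal.mul_lt_top
            (ENNReal.rpow_lt_top_of_nonneg hP.le hB.ne) ENNReal.ofReal_lt_top) ?_
          exact (ENNReal.tsum_comp_le_tsum_of_injective (add_left_injective j0) (fun j =>
            ENNReal.ofReal (Ψ (tau j) ^ P))).trans_lt hsumE
  · have hPQ : P < q.toReal := (ENNReal.toReal_lt_toReal hpt hq).2 hpq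
    set Q := q.toReal with hQdef
    have hQ : 0 < Q := hP.trans hPQ
    have hB1 := (ENNReal.rpow_lt_top_iff_of_pos (by positivity)).1 hB
    have hB2 : ∫⁻ h in {h : Fin n → ℝ | ‖h‖ ≤ 1}, DD M P f h ^ (Q / P) *
      ENNReal.ofReal (‖h‖ ^ (-(n : ℝ) - s * Q)) < ⊤ := by
      refine lt_of_eq_of_lt ?_ hB1
      refine lintegral_congr fun h => ?_
      rw [← ENNReal.rpow_mul]
      congr 2; ring
    have h1 := bsum M hM hP hQ hs hf hLp' hB2
    have hQP : 0 < Q - P := by linarith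
    have hconj : (Q / P).HolderConjugate (Q / (Q - P)) := by
      rw [Real.holderConjugate_iff]
      refine ⟨(one_lt_div hP).2 hPQ, ?_⟩
      field_simp; ring
    have h2 : ∀ j, ENNReal.ofReal (Ψ (tau j) ^ P) ^ (Q / (Q - P)) =
        ENNReal.ofReal (Ψ (tau j) ^ (Q * P / (Q - P))) := by
      intro j
      have := hΨ0 j
      rw [ENNReal.ofReal_rpow_of_nonneg (by positivity) (by positivity), ← Real.rpow_mul this.le]
      congr 2; ring
    have hr1 : 0 < Q / P := by positivity
    have hr2 : 0 < Q / (Q - P) := by positivity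
    calc _ ≤ ∑' j, ((ENNReal.ofReal (tau j ^ (-(s * P))) * bb M P f j) ^ (Q / P) /
          ENNReal.ofReal (Q / P) + ENNReal.ofReal (Ψ (tau j) ^ (Q * P / (Q - P))) /
          ENNReal.ofReal (Q / (Q - P))) := by
          refine ENNReal.tsum_le_tsum fun j => ?_
          have hτ := tau_pos j
          rw [← h2 j]
          refine le_trans (le_of_eq ?_) (ENNReal.young_inequality _ _ hconj)
          rw [ENNReal.ofReal_mul (by positivity)]; ring
      _ < ⊤ := by
          rw [ENNReal.tsum_add]
          simp only [div_eq_mul_inv]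
          rw [ENNReal.tsum_mul_right, ENNReal.tsum_mul_right]
          refine ENNReal.add_lt_top.2 ⟨ENNReal.mul_lt_top h1 ?_, ENNReal.mul_lt_top hsumE ?_⟩
          · exact ENNReal.inv_lt_top.2 (ENNReal.ofReal_pos.2 hr1)
          · exact ENNReal.inv_lt_top.2 (ENNReal.ofReal_pos.2 hr2)

lemma iterDiff_ae_eq {n : ℕ} (M : ℕ) {f g : (Fin n → ℝ) → ℝ} (hfg : f =ᵐ[volume] g)
    (h : Fin n → ℝ) : iterDiff M f h =ᵐ[volume] iterDiff M g h := by
  have : ∀ i : ℕ, ∀ᵐ x, f (x + (i : ℝ) • h) = g (x + (i : ℝ) • h) := fun i =>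
    (measurePreserving_add_right volume ((i : ℝ) • h)).quasiMeasurePreserving.ae_eq_comp hfg
  filter_upwards [ae_all_iff.2 this] with x hx
  simp only [iterDiff_eq, hx]

lemma besovNorm_congr {n : ℕ} {p q : ℝ≥0∞} {s : ℝ} {f g : (Fin n → ℝ) → ℝ}
    (hfg : f =ᵐ[volume] g) : besovNorm n p q s f = besovNorm n p q s g := by
  have : ∀ M h, eLpNorm (iterDiff M f h) p volume = eLpNorm (iterDiff M g h) p volume :=
    fun M h => eLpNorm_congr_ae (iterDiff_ae_eq M hfg h)
  simp only [besovNorm, this, eLpNorm_congr_ae hfg]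

lemma genBesovNorm_congr {n : ℕ} {p q : ℝ≥0∞} {s : ℝ} {Ψ : ℝ → ℝ} {f g : (Fin n → ℝ) → ℝ}
    (hfg : f =ᵐ[volume] g) : genBesovNorm n p q s Ψ f = genBesovNorm n p q s Ψ g := by
  have : ∀ M h, eLpNorm (iterDiff M f h) p volume = eLpNorm (iterDiff M g h) p volume :=
    fun M h => eLpNorm_congr_ae (iterDiff_ae_eq M hfg h)
  simp only [genBesovNorm, this, eLpNorm_congr_ae hfg]

lemma restrict_ae_eq (N d : ℕ) (hdN : d < N) {f g : (Fin N → ℝ) → ℝ} (hfg : f =ᵐ[volume] g) :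
    ∀ᵐ y, restrictLast N d f y =ᵐ[volume] restrictLast N d g y := by
  have h1 := ((glue_mp N d hdN).comp
    (Measure.measurePreserving_swap (μ := (volume : Measure (Fin (N - d) → ℝ)))
      (ν := (volume : Measure (Fin d → ℝ))))).quasiMeasurePreserving.ae_eq_comp hfg
  exact Measure.ae_ae_of_ae_prod h1

end BesovAux

/-- Theorem 1.6: for `0 < p < q ≤ ∞`, `s > σ_p` and an admissible `Ψ` with
`∑_j Ψ(2^{-j})^χ < ∞` (`χ = qp/(q-p)`, resp. `χ = p` if `q = ∞`), every
`f ∈ B^s_{p,q}(ℝ^N)` satisfies `f(·,y) ∈ B^{(s,Ψ)}_{p,q}(ℝ^d)` for a.e. `y ∈ ℝ^{N-d}`. -/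
theorem besov_restriction_generalized_smoothness (N d : ℕ) (hN : 2 ≤ N) (hd : 1 ≤ d)
    (hdN : d < N) (p q : ℝ≥0∞) (hp : 0 < p) (hpq : p < q)
    (s : ℝ) (hs : sigmaP N p < s)
    (Ψ : ℝ → ℝ) (hΨ : Admissible Ψ)
    (hsum : Summable fun j : ℕ => Ψ ((2 : ℝ) ^ (-(j : ℝ))) ^ chiExp p q)
    (f : (Fin N → ℝ) → ℝ) (hf : MemBesov N p q s f) :
    ∀ᵐ y ∂(MeasureTheory.volume : Measure (Fin (N - d) → ℝ)),
      MemGenBesov d p q s Ψ (restrictLast N d f y) := by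
  have hp0 : p ≠ 0 := hp.ne'
  have hpt : p ≠ ⊤ := hpq.ne_top
  have hP : 0 < p.toReal := ENNReal.toReal_pos hp0 hpt
  have hs0 : 0 < s := lt_of_le_of_lt (by unfold sigmaP; positivity) hs
  have hmono := BesovAux.monotone_of_admissible hp0 hpq hΨ hsum
  obtain ⟨hfm, hB⟩ := hf
  set g := hfm.mk f with hg
  have hgm : Measurable g := hfm.stronglyMeasurable_mk.measurable
  have hfg : f =ᵐ[volume] g := hfm.ae_eq_mk
  rw [BesovAux.besovNorm_congr hfg] at hB
  have hw := BesovAux.wsum hp0 hpq hs0 hΨ.1 hsum hgm hB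
  have hS := BesovAux.slice_sum N d hdN (⌊s⌋₊ + 1) (by omega) hP hgm _ hw
  have hLp := BesovAux.lintegral_lt_top_of_eLpNorm hp0 hpt (ENNReal.add_lt_top.1 hB).1
  have hF : Measurable fun z => ‖g z‖ₑ ^ p.toReal := hgm.enorm.pow_const _
  have hLy : ∀ᵐ y, ∫⁻ x, ‖restrictLast N d g y x‖ₑ ^ p.toReal < ⊤ := by
    refine ae_lt_top ?_ ?_
    · exact Measurable.lintegral_prod_left' (hF.comp (BesovAux.glue_mp N d hdN).measurable)
    · have := BesovAux.lintegral_slice N d hdN hF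
      simp only [BesovAux.restrictLast_eq]
      rw [this]
      exact hLp.ne
  filter_upwards [hS, hLy, BesovAux.restrict_ae_eq N d hdN hfg] with y h1 h2 h3
  refine ⟨((BesovAux.measurable_restrict N d hdN hgm y).aestronglyMeasurable).congr h3.symm, ?_⟩
  rw [BesovAux.genBesovNorm_congr h3]
  refine BesovAux.finish hp0 hpq hs0 hΨ.1 hmono ?_ h1
  rw [eLpNorm_eq_lintegral_rpow_enorm_toReal hp0 hpt]
  exact ENNReal.rpow_lt_top_of_nonneg (by positivity) h2.ne
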